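/- arXiv:1505.07788 — 3 statements merged into one kernel-verified Lean document; each statement's English description precedes it below -/
import Mathlib

section
/- Let N ≥ 2 be even, let {c_n}_{n≥1} be real, {d_{n+1}}_{n≥1} a positive chain sequence, and let −1 < A < B < 1 satisfy conditions (a) A/√(1−A²) < c_1 < B/√(1−B²) and (b) {𝔡_{n+1}(A)}_{n=1}^{N−1} and {𝔡_{n+1}(B)}_{n=1}^{N−1} are finite positive chain sequences. Suppose there exist C, D with A < C < D < B and an ℓ ∈ {0,1} such that for every n with 1 ≤ n ≤ N/2 one has A/√(1−A²) < c_{2n−ℓ} < C/√(1−C²) and D/√(1−D²) < c_{2n−1+ℓ} < B/√(1−B²). Then for every n with 1 ≤ n ≤ N, all zeros of W_n in [−1,1] lie in (A,C) ∪ (D,B). -/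
noncomputable section

/-- The functions `W n`, where `W c d n x` is `W_n(x)`: `W_0 = 1`, `W_1(x) = x - c_1*sqrt(1-x^2)`,
`W_{n+1}(x) = (x - c_{n+1}*sqrt(1-x^2)) W_n(x) - d_{n+1} W_{n-1}(x)`. -/
def W (c d : ℕ → ℝ) : ℕ → ℝ → ℝ
  | 0, _ => 1
  | 1, x => x - c 1 * Real.sqrt (1 - x ^ 2)
  | n + 2, x =>
      (x - c (n + 2) * Real.sqrt (1 - x ^ 2)) * W c d (n + 1) x - d (n + 2) * W c d n x

/-- `{d_{n+1}}_{n≥1}` is a positive chain sequence: there is a parameter sequence `g` with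
`0 ≤ g_1 < 1`, `0 < g_n < 1` for `n ≥ 2`, and `d_{n+1} = (1 - g_n) g_{n+1}` for `n ≥ 1`. -/
def IsPositiveChainSeq (d : ℕ → ℝ) : Prop :=
  ∃ g : ℕ → ℝ, (0 ≤ g 1 ∧ g 1 < 1) ∧ (∀ n, 2 ≤ n → 0 < g n ∧ g n < 1) ∧
    ∀ n, 1 ≤ n → d (n + 1) = (1 - g n) * g (n + 1)

/-- `{d_{n+1}}_{n=1}^{N-1}` is a finite positive chain sequence: there are `g_1, ..., g_N` with
`0 ≤ g_1 < 1`, `0 < g_n < 1` for `2 ≤ n ≤ N`, and `d_{n+1} = (1 - g_n) g_{n+1}` for `1 ≤ n ≤ N-1`. -/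
def IsFinitePositiveChainSeq (N : ℕ) (d : ℕ → ℝ) : Prop :=
  ∃ g : ℕ → ℝ, (0 ≤ g 1 ∧ g 1 < 1) ∧ (∀ n, 2 ≤ n → n ≤ N → 0 < g n ∧ g n < 1) ∧
    ∀ n, 1 ≤ n → n ≤ N - 1 → d (n + 1) = (1 - g n) * g (n + 1)

/-- `frakd c d n x` is `𝔡_{n+1}(x) = d_{n+1} / ((x - c_n √(1-x²))(x - c_{n+1} √(1-x²)))`. -/
def frakd (c d : ℕ → ℝ) (n : ℕ) (x : ℝ) : ℝ :=
  d (n + 1) / ((x - c n * Real.sqrt (1 - x ^ 2)) * (x - c (n + 1) * Real.sqrt (1 - x ^ 2)))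

theorem IsPositiveChainSeq.pos {d : ℕ → ℝ} (hd : IsPositiveChainSeq d) {n : ℕ} (hn : 1 ≤ n) :
    0 < d (n + 1) := by
  obtain ⟨g, ⟨_, h1⟩, hg, hdg⟩ := hd
  rw [hdg n hn]
  have hlt : g n < 1 := by
    rcases hn.eq_or_lt with rfl | h
    · exact h1
    · exact (hg n h).2
  exact mul_pos (by linarith) (hg (n + 1) (by omega)).1

theorem sqrt_one_sub_sq_pos {x : ℝ} (hx : -1 < x) (hx' : x < 1) : 0 < √(1 - x ^ 2) :=
  Real.sqrt_pos.2 (by nlinarith)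

/-- Cross-multiplied monotonicity of `x / √(1 - x²)`. -/
theorem mul_sqrt_one_sub_sq_le {x y : ℝ} (hxy : x ≤ y) :
    x * √(1 - y ^ 2) ≤ y * √(1 - x ^ 2) := by
  have hsx := Real.sqrt_nonneg (1 - x ^ 2)
  have hsy := Real.sqrt_nonneg (1 - y ^ 2)
  rcases le_total 0 x with h0 | h0
  · have h : √(1 - y ^ 2) ≤ √(1 - x ^ 2) := Real.sqrt_le_sqrt (by nlinarith)
    exact mul_le_mul hxy h hsy (h0.trans hxy)
  · rcases le_total 0 y with h1 | h1
    · nlinarith [mul_nonneg h1 hsx, mul_nonneg (neg_nonneg.2 h0) hsy]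
    · have h : √(1 - x ^ 2) ≤ √(1 - y ^ 2) := Real.sqrt_le_sqrt (by nlinarith)
      nlinarith [mul_nonneg (neg_nonneg.2 h1) (sub_nonneg.2 h),
        mul_nonneg (sub_nonneg.2 hxy) hsy]

theorem sqrt_one_sub_sq_mul_one_add_le {x y : ℝ} (hx : -1 ≤ x) (hxy : x ≤ y) (hy : y ≤ 1) :
    √(1 - y ^ 2) * (1 + x) ≤ √(1 - x ^ 2) * (1 + y) := by
  have hx0 : 0 ≤ 1 + x := by linarith
  have hy0 : 0 ≤ 1 + y := by linarith
  refine abs_le_of_sq_le_sq' ?_ (by positivity) |>.2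
  rw [mul_pow, mul_pow, Real.sq_sqrt (by nlinarith), Real.sq_sqrt (by nlinarith)]
  have h : (1 - y) * (1 + x) ≤ (1 - x) * (1 + y) := by linarith
  nlinarith [mul_le_mul_of_nonneg_left h (mul_nonneg hx0 hy0)]

theorem sub_mul_sqrt_neg {c x y : ℝ} (hx : -1 < x) (hxy : x ≤ y) (hy : y < 1)
    (hc : y / √(1 - y ^ 2) < c) : x - c * √(1 - x ^ 2) < 0 := by
  have hsx := sqrt_one_sub_sq_pos hx (hxy.trans_lt hy)
  have hsy := sqrt_one_sub_sq_pos (hx.trans_le hxy) hy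
  rw [div_lt_iff₀ hsy] at hc
  have h := mul_sqrt_one_sub_sq_le hxy
  have h' := mul_lt_mul_of_pos_right hc hsx
  nlinarith

theorem sub_mul_sqrt_pos {c x y : ℝ} (hx : -1 < x) (hxy : x ≤ y) (hy : y < 1)
    (hc : c < x / √(1 - x ^ 2)) : 0 < y - c * √(1 - y ^ 2) := by
  have h := sub_mul_sqrt_neg (c := -c) (x := -y) (y := -x) (by linarith) (by linarith)
    (by linarith) (by rw [neg_sq, neg_div]; linarith)
  rw [neg_sq] at h
  linarith

theorem W_ne_zero_of_alternating {c d : ℕ → ℝ} {N : ℕ} {x : ℝ} (hd : ∀ n, 1 ≤ n → 0 < d (n + 1))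
    (hu : ∀ n, 1 ≤ n → n + 1 ≤ N →
      (x - c n * √(1 - x ^ 2)) * (x - c (n + 1) * √(1 - x ^ 2)) < 0)
    (hu1 : x - c 1 * √(1 - x ^ 2) ≠ 0) {n : ℕ} (hn : n ≤ N) : W c d n x ≠ 0 := by
  have key : ∀ n, n + 1 ≤ N →
      0 < (x - c (n + 1) * √(1 - x ^ 2)) * (W c d (n + 1) x * W c d n x) := by
    intro n
    induction n with
    | zero =>
      intro _
      simp only [W, mul_one, zero_add]
      exact mul_self_pos.2 hu1
    | succ n ih =>
      intro hN
      have h := ih (by omega)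
      have hneg := hu (n + 1) (by omega) hN
      have hdn := hd (n + 1) (by omega)
      simp only [W]
      set u := x - c (n + 1) * √(1 - x ^ 2)
      set v := x - c (n + 2) * √(1 - x ^ 2)
      have hw : W c d (n + 1) x ≠ 0 := by
        rintro h0
        simp [h0] at h
      have hv : v ≠ 0 := by
        intro h0
        simp [v, h0] at hneg
      have hvw : v * (W c d (n + 1) x * W c d n x) < 0 := by
        by_contra! hcon
        nlinarith [mul_nonneg hcon h.le, mul_pos (mul_self_pos.2 hw) h,
          mul_pos (neg_pos.2 hneg) (mul_self_pos.2 (right_ne_zero_of_mul h.ne'))]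
      nlinarith [mul_pos (mul_self_pos.2 hv) (mul_self_pos.2 hw), mul_pos hdn (neg_pos.2 hvw)]
  cases n with
  | zero => simp [W]
  | succ n => exact left_ne_zero_of_mul (right_ne_zero_of_mul (key n hn).ne')

/-- If the diagonal entries `c_n √(1 - x²) - x` dominate `p_n + d_n / p_{n-1}` for some positive
`p`, then all `W_n(x)` are nonzero with sign `(-1) ^ n`. -/
theorem W_sign_of_dominated {c d p : ℕ → ℝ} {N : ℕ} {x : ℝ} (hd : ∀ n, 1 ≤ n → 0 < d (n + 1))
    (hp : ∀ n, 1 ≤ n → n ≤ N → 0 < p n) (hp1 : p 1 ≤ c 1 * √(1 - x ^ 2) - x)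
    (hpd : ∀ n, 1 ≤ n → n + 1 ≤ N →
      p (n + 1) + d (n + 1) / p n ≤ c (n + 1) * √(1 - x ^ 2) - x)
    {n : ℕ} (hn : n ≤ N) : 0 < (-1) ^ n * W c d n x := by
  have key : ∀ n, n + 1 ≤ N → 0 < (-1) ^ n * W c d n x ∧
      p (n + 1) * ((-1) ^ n * W c d n x) ≤ (-1) ^ (n + 1) * W c d (n + 1) x := by
    intro n
    induction n with
    | zero =>
      intro _
      simp only [W]
      constructor <;> norm_num
      linarith
    | succ n ih =>
      intro hN
      obtain ⟨h0, h1⟩ := ih (by omega)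
      have hpn := hp (n + 1) (by omega) (by omega)
      have hdn := hd (n + 1) (by omega)
      have hpos := (mul_pos hpn h0).trans_le h1
      refine ⟨hpos, ?_⟩
      have hrec : (-1) ^ (n + 1 + 1) * W c d (n + 1 + 1) x =
          (c (n + 2) * √(1 - x ^ 2) - x) * ((-1) ^ (n + 1) * W c d (n + 1) x)
            - d (n + 2) * ((-1) ^ n * W c d n x) := by
        simp only [W]
        ring
      rw [hrec]
      have h2 := mul_le_mul_of_nonneg_right (hpd (n + 1) (by omega) hN) hpos.le
      have h3 := mul_le_mul_of_nonneg_left h1 (div_pos hdn hpn).le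
      rw [← mul_assoc, div_mul_cancel₀ _ hpn.ne'] at h3
      rw [add_mul] at h2
      linarith
  cases n with
  | zero => simp [W]
  | succ n =>
    obtain ⟨h0, h1⟩ := key n hn
    exact (mul_pos (hp (n + 1) (by omega) hn) h0).trans_le h1

theorem one_div_add_le {a b p q : ℝ} (ha : 0 ≤ a) (hb : 0 ≤ b) (hab : 1 ≤ a + b) (hp : 0 < p)
    (hq : 0 < q) : 1 / (a * p + b * q) ≤ a / p + b / q := by
  have hpos : 0 < a * p + b * q := by
    rcases ha.eq_or_lt with rfl | ha'
    · have : 0 < b := by linarith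
      positivity
    · positivity
  rw [div_add_div _ _ hp.ne' hq.ne', div_le_div_iff₀ hpos (mul_pos hp hq)]
  have h : 1 ≤ (a + b) ^ 2 := by nlinarith
  nlinarith [mul_le_mul_of_nonneg_right h (mul_pos hp hq).le,
    mul_nonneg (mul_nonneg ha hb) (sq_nonneg (p - q))]

theorem W_sign_of_le {c d : ℕ → ℝ} {N : ℕ} {A x : ℝ} (hN : 1 ≤ N) (hd : IsPositiveChainSeq d)
    (hA : -1 < A) (hA1 : A < 1) (hu : ∀ n, 1 ≤ n → n ≤ N → A - c n * √(1 - A ^ 2) < 0)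
    (hchain : IsFinitePositiveChainSeq N (fun k => frakd c d (k - 1) A))
    (hx : -1 ≤ x) (hxA : x ≤ A) {n : ℕ} (hn : n ≤ N) : 0 < (-1) ^ n * W c d n x := by
  have hdpos : ∀ n, 1 ≤ n → 0 < d (n + 1) := fun n hn => hd.pos hn
  obtain ⟨h, ⟨h10, h11⟩, hh, hdh⟩ := hd
  obtain ⟨g, ⟨g10, g11⟩, hg, hdg⟩ := hchain
  have hh1 : ∀ n, 1 ≤ n → 0 < 1 - h n := fun n hn => by
    rcases hn.eq_or_lt with rfl | hn'
    · linarith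
    · linarith [(hh n hn').2]
  have hg1 : ∀ n, 1 ≤ n → n ≤ N → 0 < 1 - g n := fun n hn hnN => by
    rcases hn.eq_or_lt with rfl | hn'
    · linarith
    · linarith [(hg n hn' hnN).2]
  have hsA := sqrt_one_sub_sq_pos hA hA1
  set s := √(1 - x ^ 2) with hs
  set t := √(1 - A ^ 2) with ht
  have hs0 : 0 ≤ s := Real.sqrt_nonneg _
  -- `(x, s) = α • (A, t) + β • (-1, 0)` with `α, β ≥ 0` and `α + β ≥ 1`.
  obtain ⟨α, hα⟩ : ∃ α, α = s / t := ⟨_, rfl⟩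
  have hαs : α * t = s := by rw [hα, div_mul_cancel₀ _ hsA.ne']
  have hα0 : 0 ≤ α := hα ▸ div_nonneg hs0 hsA.le
  obtain ⟨β, hβ⟩ : ∃ β, β = α * A - x := ⟨_, rfl⟩
  have hβ0 : 0 ≤ β := by
    have := mul_sqrt_one_sub_sq_le hxA
    rw [← hs, ← ht, ← hαs] at this
    by_contra! hcon
    nlinarith
  have hαβ : 1 ≤ α + β := by
    have := sqrt_one_sub_sq_mul_one_add_le hx hxA hA1.le
    rw [← hs, ← ht, ← hαs] at this
    by_contra! hcon
    nlinarith
  have hdiag : ∀ n, c n * s - x = α * (c n * t - A) + β := fun n => by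
    rw [← hαs, hβ]
    ring
  have hP : ∀ n, 1 ≤ n → n ≤ N → 0 < (1 - g n) * (c n * t - A) := fun n hn hnN =>
    mul_pos (hg1 n hn hnN) (by linarith [hu n hn hnN])
  refine W_sign_of_dominated (N := N)
    (p := fun n => α * ((1 - g n) * (c n * t - A)) + β * (1 - h n)) hdpos ?_ ?_ ?_ hn
  · intro n hn hnN
    have h1 := hP n hn hnN
    have h2 := hh1 n hn
    rcases hα0.eq_or_lt with h0 | h0
    · have : 0 < β := by linarith
      positivity
    · positivity
  · rw [← hs, hdiag]
    have := hu 1 le_rfl hN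
    have h1 : 0 ≤ α * (g 1 * (c 1 * t - A)) :=
      mul_nonneg hα0 (mul_nonneg g10 (by linarith))
    nlinarith [mul_nonneg hβ0 h10]
  · intro n hn hnN
    rw [← hs, hdiag]
    have hPn := hP n hn (by omega)
    have hQn := hh1 n hn
    have hdn := hdpos n hn
    have hconv := mul_le_mul_of_nonneg_left (one_div_add_le hα0 hβ0 hαβ hPn hQn) hdn.le
    have hA' : d (n + 1) / ((1 - g n) * (c n * t - A)) = g (n + 1) * (c (n + 1) * t - A) := by
      have hf := hdg n hn (by omega)
      simp only [frakd, Nat.add_sub_cancel] at hf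
      rw [← ht] at hf
      have hun := hu n hn (by omega)
      have hun1 := hu (n + 1) (by omega) hnN
      rw [div_eq_iff (mul_pos_of_neg_of_neg hun hun1).ne'] at hf
      rw [div_eq_iff hPn.ne', hf]
      ring
    have h1' : d (n + 1) / (1 - h n) = h (n + 1) := by
      rw [div_eq_iff hQn.ne', hdh n hn]
      ring
    have hsplit : d (n + 1) * (α / ((1 - g n) * (c n * t - A)) + β / (1 - h n)) =
        α * (g (n + 1) * (c (n + 1) * t - A)) + β * h (n + 1) := by
      rw [← hA', ← h1']
      ring
    rw [hsplit, mul_one_div] at hconv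
    linarith

theorem W_neg (c d : ℕ → ℝ) (x : ℝ) (n : ℕ) :
    W (fun k => -c k) d n (-x) = (-1) ^ n * W c d n x := by
  induction n using Nat.twoStepInduction with
  | zero => simp [W]
  | one => simp only [W, neg_sq]; ring
  | more n ih1 ih2 =>
    simp only [W, ih1, ih2, neg_sq]
    ring

theorem frakd_neg (c d : ℕ → ℝ) (n : ℕ) (x : ℝ) :
    frakd (fun k => -c k) d n (-x) = frakd c d n x := by
  simp only [frakd, neg_sq]
  congr 1
  ring

theorem W_pos_of_ge {c d : ℕ → ℝ} {N : ℕ} {B x : ℝ} (hN : 1 ≤ N) (hd : IsPositiveChainSeq d)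
    (hB1 : -1 < B) (hB : B < 1) (hu : ∀ n, 1 ≤ n → n ≤ N → 0 < B - c n * √(1 - B ^ 2))
    (hchain : IsFinitePositiveChainSeq N (fun k => frakd c d (k - 1) B))
    (hx : x ≤ 1) (hBx : B ≤ x) {n : ℕ} (hn : n ≤ N) : 0 < W c d n x := by
  have h := W_sign_of_le (c := fun k => -c k) (A := -B) (x := -x) hN hd (by linarith)
    (by linarith) (fun n hn hnN => by rw [neg_sq]; linarith [hu n hn hnN])
    (by simpa only [frakd_neg] using hchain) (by linarith) (by linarith) hn
  rwa [W_neg, ← mul_assoc, ← mul_pow, neg_one_mul, neg_neg, one_pow, one_mul] at h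

theorem stmt1 (N : ℕ) (hN : 2 ≤ N) (hNeven : Even N) (c d : ℕ → ℝ)
    (hd : IsPositiveChainSeq d)
    (A B C D : ℝ) (hA : -1 < A) (hAC : A < C) (hCD : C < D) (hDB : D < B) (hB : B < 1)
    (ha1 : A / Real.sqrt (1 - A ^ 2) < c 1) (ha2 : c 1 < B / Real.sqrt (1 - B ^ 2))
    (hbA : IsFinitePositiveChainSeq N (fun k => frakd c d (k - 1) A))
    (hbB : IsFinitePositiveChainSeq N (fun k => frakd c d (k - 1) B))
    (l : ℕ) (hl : l = 0 ∨ l = 1)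
    (hlow : ∀ n, 1 ≤ n → n ≤ N / 2 →
      A / Real.sqrt (1 - A ^ 2) < c (2 * n - l) ∧ c (2 * n - l) < C / Real.sqrt (1 - C ^ 2))
    (hhigh : ∀ n, 1 ≤ n → n ≤ N / 2 →
      D / Real.sqrt (1 - D ^ 2) < c (2 * n - 1 + l) ∧
        c (2 * n - 1 + l) < B / Real.sqrt (1 - B ^ 2)) :
    ∀ n, 1 ≤ n → n ≤ N → ∀ x ∈ Set.Icc (-1 : ℝ) 1, W c d n x = 0 →
      (A < x ∧ x < C) ∨ (D < x ∧ x < B) := by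
  have hlowhigh : ∀ n, 1 ≤ n → n ≤ N →
      (A / √(1 - A ^ 2) < c n ∧ c n < C / √(1 - C ^ 2) ∧ Even (n + l)) ∨
      (D / √(1 - D ^ 2) < c n ∧ c n < B / √(1 - B ^ 2) ∧ ¬ Even (n + l)) := by
    intro n hn hnN
    obtain ⟨M, rfl⟩ := hNeven
    rcases Nat.even_or_odd' n with ⟨k, rfl | rfl⟩ <;> rcases hl with rfl | rfl
    · have h := hlow k (by omega) (by omega)
      exact Or.inl ⟨h.1, h.2, by simp⟩
    · have h := hhigh k (by omega) (by omega)
      rw [show 2 * k - 1 + 1 = 2 * k by omega] at h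
      exact Or.inr ⟨h.1, h.2, by simp [parity_simps]⟩
    · have h := hhigh (k + 1) (by omega) (by omega)
      rw [show 2 * (k + 1) - 1 + 0 = 2 * k + 1 by omega] at h
      exact Or.inr ⟨h.1, h.2, by simp [parity_simps]⟩
    · have h := hlow (k + 1) (by omega) (by omega)
      rw [show 2 * (k + 1) - 1 = 2 * k + 1 by omega] at h
      exact Or.inl ⟨h.1, h.2, by simp [parity_simps]⟩
  intro n _ hnN x hx hW
  by_contra! hcon
  rcases le_or_gt x A with hxA | hAx
  · have h := W_sign_of_le (by omega) hd hA (by linarith) (fun k hk hkN => by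
      rcases hlowhigh k hk hkN with h | h
      · exact sub_mul_sqrt_neg hA le_rfl (by linarith) h.1
      · exact sub_mul_sqrt_neg hA (by linarith) (by linarith) h.1) hbA hx.1 hxA hnN
    simp [hW] at h
  rcases le_or_gt B x with hBx | hxB
  · have h := W_pos_of_ge (by omega) hd (by linarith) hB (fun k hk hkN => by
      rcases hlowhigh k hk hkN with h | h
      · exact sub_mul_sqrt_pos (by linarith) (by linarith) hB h.2.1
      · exact sub_mul_sqrt_pos (by linarith) le_rfl hB h.2.1) hbB hx.2 hBx hnN
    exact h.ne' hW
  have hCx := hcon.1 hAx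
  have hxD : x ≤ D := by
    by_contra! hDx
    linarith [hcon.2 hDx]
  have hsign : ∀ k, 1 ≤ k → k ≤ N →
      (0 < x - c k * √(1 - x ^ 2) ∧ Even (k + l)) ∨
      (x - c k * √(1 - x ^ 2) < 0 ∧ ¬ Even (k + l)) := by
    intro k hk hkN
    rcases hlowhigh k hk hkN with h | h
    · exact Or.inl ⟨sub_mul_sqrt_pos (by linarith) hCx (by linarith) h.2.1, h.2.2⟩
    · exact Or.inr ⟨sub_mul_sqrt_neg (by linarith) hxD (by linarith) h.1, h.2.2⟩
  refine W_ne_zero_of_alternating (fun k hk => hd.pos hk) (fun k hk hkN => ?_) ?_ hnN hW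
  · have hpar : Even (k + 1 + l) ↔ ¬ Even (k + l) := by
      rw [add_right_comm, Nat.even_add_one]
    rcases hsign k hk (by omega) with h | h <;> rcases hsign (k + 1) (by omega) hkN with h' | h'
    · exact absurd h.2 (hpar.1 h'.2)
    · exact mul_neg_of_pos_of_neg h.1 h'.1
    · exact mul_neg_of_neg_of_pos h.1 h'.1
    · exact absurd (hpar.2 h.2) h'.2
  · rcases hsign 1 le_rfl (by omega) with h | h
    · exact h.1.ne'
    · exact h.1.ne
end
end

section
/- Let λ > −1/2 and N ≥ 2. For n ≥ 1 set d_{n+1}^{(λ)} = (1/4)·n(n+2λ+1)/((n+λ)(n+λ+1)), so that in particular d_{n+1}^{(−1/2)} = n²/(4n²−1). Let x_1^{(N)} denote the largest zero of the monic Legendre polynomial of degree N, i.e., of the polynomial W_N defined by W_0(x)=1, W_1(x)=x, W_{n+1}(x) = x W_n(x) − d_{n+1}^{(−1/2)} W_{n−1}(x). Then the sequence {d_{n+1}^{(−1/2)}/cos²(π/(2N))}_{n=1}^{N−1} is a finite positive chain sequence, and for all 1 ≤ n ≤ N−1 one has d_{n+1}^{(λ)} < d_{n+1}^{(−1/2)}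 < d_{n+1}^{(−1/2)}/cos²(π/(2N)) < d_{n+1}^{(−1/2)}/(x_1^{(N)})². -/
noncomputable section

lemma W_zero_one (d : ℕ → ℝ) (x : ℝ) : W (fun _ => 0) d 1 x = x := by
  simp [W]

lemma W_zero_add_two (d : ℕ → ℝ) (n : ℕ) (x : ℝ) :
    W (fun _ => 0) d (n + 2) x =
      x * W (fun _ => 0) d (n + 1) x - d (n + 2) * W (fun _ => 0) d n x := by
  simp [W]

lemma continuous_W (c d : ℕ → ℝ) (n : ℕ) : Continuous (W c d n) := by
  induction n using Nat.twoStepInduction with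
  | zero => exact continuous_const
  | one =>
    change Continuous fun x => x - c 1 * Real.sqrt (1 - x ^ 2)
    fun_prop
  | more n ih₀ ih₁ =>
    change Continuous fun x =>
      (x - c (n + 2) * Real.sqrt (1 - x ^ 2)) * W c d (n + 1) x - d (n + 2) * W c d n x
    fun_prop

/-- The ratio of consecutive polynomials increases to the right of a point where the lower ones
are positive. -/
lemma W_ratio_lt {d : ℕ → ℝ} (hd : ∀ k, 0 < d (k + 2)) {x y : ℝ} (hxy : x < y) (n : ℕ)
    (hpos : ∀ k ≤ n, 0 < W (fun _ => 0) d k x) :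
    0 < W (fun _ => 0) d n y ∧
      W (fun _ => 0) d (n + 1) x * W (fun _ => 0) d n y <
        W (fun _ => 0) d (n + 1) y * W (fun _ => 0) d n x := by
  induction n with
  | zero => simpa [W] using hxy
  | succ n ih =>
    obtain ⟨hy, hlt⟩ := ih fun k hk => hpos k (by omega)
    have hx := hpos n (by omega)
    have hx' := hpos (n + 1) le_rfl
    have hy' : 0 < W (fun _ => 0) d (n + 1) y :=
      pos_of_mul_pos_left ((mul_pos hx' hy).trans hlt) hx.le
    refine ⟨hy', ?_⟩
    rw [W_zero_add_two, W_zero_add_two]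
    linarith [mul_pos (sub_pos.2 hxy) (mul_pos hx' hy'), mul_pos (hd n) (sub_pos.2 hlt)]

lemma W_pos_of_le {d : ℕ → ℝ} (hd : ∀ k, 0 < d (k + 2)) {x y : ℝ} (hxy : x ≤ y) {n : ℕ}
    (hpos : ∀ k ≤ n, 0 < W (fun _ => 0) d k x) {k : ℕ} (hk : k ≤ n) :
    0 < W (fun _ => 0) d k y := by
  rcases hxy.eq_or_lt with rfl | hlt
  · exact hpos k hk
  · exact (W_ratio_lt hd hlt k fun j hj => hpos j (hj.trans hk)).1

lemma exists_pos_zero_W {d : ℕ → ℝ} (hd : ∀ k, 0 < d (k + 2)) {x : ℝ} (n : ℕ)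
    (hpos : ∀ k ≤ n + 2, 0 < W (fun _ => 0) d k x) :
    ∃ r, 0 < r ∧ W (fun _ => 0) d (n + 2) r = 0 ∧
      ∀ k ≤ n + 1, 0 < W (fun _ => 0) d k r := by
  induction n with
  | zero =>
    have hs : 0 < Real.sqrt (d 2) := Real.sqrt_pos.2 (hd 0)
    refine ⟨Real.sqrt (d 2), hs, ?_, ?_⟩
    · rw [W_zero_add_two, W_zero_one, Real.mul_self_sqrt (hd 0).le]
      simp [W]
    · intro k hk
      interval_cases k
      · simp [W]
      · rwa [W_zero_one]
  | succ n ih =>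
    obtain ⟨r, hr, hzero, hrpos⟩ := ih fun k hk => hpos k (by omega)
    have hrx : r < x := by
      by_contra! hle
      exact (W_pos_of_le hd hle hpos (k := n + 2) (by omega)).ne' hzero
    have hneg : W (fun _ => 0) d (n + 3) r < 0 := by
      rw [W_zero_add_two, hzero]
      linarith [mul_pos (hd (n + 1)) (hrpos (n + 1) le_rfl)]
    obtain ⟨s, hs, hszero⟩ := intermediate_value_Ioo hrx.le
      (continuous_W (fun _ => 0) d (n + 3)).continuousOn ⟨hneg, hpos (n + 3) le_rfl⟩
    refine ⟨s, hr.trans hs.1, hszero, fun k hk => ?_⟩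
    rcases Nat.lt_or_ge k (n + 2) with hk' | hk'
    · exact W_pos_of_le hd hs.1.le hrpos (by omega)
    · obtain rfl : k = n + 2 := by omega
      have hlt := (W_ratio_lt hd hs.1 (n + 1) hrpos).2
      rw [hzero, zero_mul] at hlt
      exact pos_of_mul_pos_left hlt (hrpos (n + 1) le_rfl).le

lemma isFinitePositiveChainSeq_div_sq {d : ℕ → ℝ} (hd : ∀ k, 0 < d (k + 2)) {x : ℝ}
    (hx : 0 < x) {N : ℕ} (hpos : ∀ k ≤ N, 0 < W (fun _ => 0) d k x) :
    IsFinitePositiveChainSeq N (fun k => d k / x ^ 2) := by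
  have hg : ∀ n, n + 1 ≤ N →
      1 - W (fun _ => 0) d (n + 2) x / (x * W (fun _ => 0) d (n + 1) x) =
        d (n + 2) * W (fun _ => 0) d n x / (x * W (fun _ => 0) d (n + 1) x) := by
    intro n hn
    have := (hpos (n + 1) hn).ne'
    rw [W_zero_add_two]
    field_simp
    ring
  refine ⟨fun n => 1 - W (fun _ => 0) d n x / (x * W (fun _ => 0) d (n - 1) x), ?_, ?_, ?_⟩
  · simp [W, hx.ne']
  · rintro n hn hnN
    obtain ⟨m, rfl⟩ := Nat.exists_eq_add_of_le' hn
    have h₀ := hpos m (by omega)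
    have h₁ := hpos (m + 1) (by omega)
    have h₂ := hpos (m + 2) hnN
    refine ⟨?_, sub_lt_self _ (div_pos h₂ (mul_pos hx h₁))⟩
    change 0 < 1 - W (fun _ => 0) d (m + 2) x / (x * W (fun _ => 0) d (m + 1) x)
    rw [hg m (by omega)]
    exact div_pos (mul_pos (hd m) h₀) (mul_pos hx h₁)
  · rintro n hn hnN
    obtain ⟨m, rfl⟩ := Nat.exists_eq_add_of_le' hn
    have h₀ := (hpos m (by omega)).ne'
    have h₁ := (hpos (m + 1) (by omega)).ne'
    change d (m + 2) / x ^ 2 =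
      (1 - (1 - W (fun _ => 0) d (m + 1) x / (x * W (fun _ => 0) d m x))) *
        (1 - W (fun _ => 0) d (m + 2) x / (x * W (fun _ => 0) d (m + 1) x))
    rw [hg m (by omega)]
    field_simp
    ring

/-- The monic Legendre polynomials, compared with the Chebyshev polynomials `cos (n * θ)`. -/
lemma legendre_W_pos_and_chebyshev_ratio_le {d : ℕ → ℝ}
    (hd : ∀ n : ℕ, 1 ≤ n → d (n + 1) = (n : ℝ) ^ 2 / (4 * (n : ℝ) ^ 2 - 1))
    {N : ℕ} {θ : ℝ} (hθ : 0 < θ) (hNθ : N * θ ≤ Real.pi / 2) (hcos : 0 < Real.cos θ)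
    (n : ℕ) (hn : n + 1 ≤ N) :
    0 < W (fun _ => 0) d n (Real.cos θ) ∧ 0 < W (fun _ => 0) d (n + 1) (Real.cos θ) ∧
      (n + 1) * Real.cos ((n + 1) * θ) * W (fun _ => 0) d n (Real.cos θ) ≤
        (2 * n + 1) * Real.cos (n * θ) * W (fun _ => 0) d (n + 1) (Real.cos θ) := by
  induction n with
  | zero => simp [W, hcos]
  | succ n ih =>
    obtain ⟨h₀, h₁, hle⟩ := ih (by omega)
    have hn₀ : (0 : ℝ) ≤ n := n.cast_nonneg
    have hnN : (n : ℝ) + 2 ≤ N := by exact_mod_cast hn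
    have hbound : ((n : ℝ) + 2) * θ ≤ Real.pi / 2 :=
      (mul_le_mul_of_nonneg_right hnN hθ.le).trans hNθ
    have hpos₁ : 0 < ((n : ℝ) + 1) * θ := by positivity
    have hC₁ : 0 < Real.cos ((n + 1) * θ) :=
      Real.cos_pos_of_mem_Ioo ⟨by linarith [Real.pi_pos], by linarith⟩
    have hC₂ : 0 ≤ Real.cos ((n + 2) * θ) :=
      Real.cos_nonneg_of_mem_Icc ⟨by linarith [Real.pi_pos], hbound⟩
    have hS : 0 < Real.sin θ * Real.sin ((n + 1) * θ) :=
      mul_pos (Real.sin_pos_of_pos_of_lt_pi hθ (by nlinarith [Real.pi_pos]))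
        (Real.sin_pos_of_pos_of_lt_pi hpos₁ (by linarith [Real.pi_pos]))
    have hadd : Real.cos ((n + 2) * θ) =
        Real.cos ((n + 1) * θ) * Real.cos θ - Real.sin ((n + 1) * θ) * Real.sin θ := by
      rw [← Real.cos_add]; ring_nf
    have hsub : Real.cos (n * θ) =
        Real.cos ((n + 1) * θ) * Real.cos θ + Real.sin ((n + 1) * θ) * Real.sin θ := by
      rw [← Real.cos_sub]; ring_nf
    have hrec : (2 * (n : ℝ) + 1) * (2 * n + 3) * W (fun _ => 0) d (n + 2) (Real.cos θ) =
        (2 * n + 1) * (2 * n + 3) * (Real.cos θ * W (fun _ => 0) d (n + 1) (Real.cos θ)) -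
          (n + 1) ^ 2 * W (fun _ => 0) d n (Real.cos θ) := by
      have hden : 4 * ((n : ℝ) + 1) ^ 2 - 1 = (2 * n + 1) * (2 * n + 3) := by ring
      rw [W_zero_add_two, hd (n + 1) (by omega), Nat.cast_add_one, hden]
      field_simp
    have hlt : (n + 2) * Real.cos ((n + 2) * θ) * W (fun _ => 0) d (n + 1) (Real.cos θ) <
        (2 * n + 3) * Real.cos ((n + 1) * θ) * W (fun _ => 0) d (n + 2) (Real.cos θ) := by
      refine lt_of_mul_lt_mul_left (a := 2 * (n : ℝ) + 1) ?_ (by positivity)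
      have hgap : 0 < (2 * (n : ℝ) + 1) * (Real.sin θ * Real.sin ((n + 1) * θ)) *
          W (fun _ => 0) d (n + 1) (Real.cos θ) := by positivity
      have hle' := mul_le_mul_of_nonneg_left hle (by positivity : 0 ≤ (n : ℝ) + 1)
      rw [hsub] at hle'
      rw [hadd]
      linear_combination hgap + hle' - Real.cos ((n + 1) * θ) * hrec
    refine ⟨h₁, ?_, ?_⟩
    · have h : 0 < (2 * (n : ℝ) + 3) * Real.cos ((n + 1) * θ) *
          W (fun _ => 0) d (n + 2) (Real.cos θ) := lt_of_le_of_lt (by positivity) hlt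
      exact pos_of_mul_pos_right h (by positivity)
    · push_cast
      rw [show (n : ℝ) + 1 + 1 = n + 2 by ring, show 2 * ((n : ℝ) + 1) + 1 = 2 * n + 3 by ring]
      exact hlt.le

lemma legendre_W_pos {d : ℕ → ℝ}
    (hd : ∀ n : ℕ, 1 ≤ n → d (n + 1) = (n : ℝ) ^ 2 / (4 * (n : ℝ) ^ 2 - 1))
    {N : ℕ} {θ : ℝ} (hθ : 0 < θ) (hNθ : N * θ ≤ Real.pi / 2) (hcos : 0 < Real.cos θ)
    {k : ℕ} (hk : k ≤ N) : 0 < W (fun _ => 0) d k (Real.cos θ) := by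
  cases k with
  | zero => simp [W]
  | succ n => exact (legendre_W_pos_and_chebyshev_ratio_le hd hθ hNθ hcos n hk).2.1

lemma ultraspherical_coeff_lt_legendre_coeff {lam t : ℝ} (hlam : -(1 / 2) < lam) (ht : 1 ≤ t) :
    1 / 4 * (t * (t + 2 * lam + 1)) / ((t + lam) * (t + lam + 1)) <
      t ^ 2 / (4 * t ^ 2 - 1) := by
  have h₁ : 0 < t + lam := by linarith
  have h₂ : 0 < t + lam + 1 := by linarith
  have h₃ : 0 < 4 * t ^ 2 - 1 := by nlinarith
  have h₄ : 0 < 2 * lam + 1 := by linarith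
  have ht₀ : 0 < t := by linarith
  rw [div_lt_div_iff₀ (mul_pos h₁ h₂) h₃]
  have h₅ : 0 < t * (t * (2 * lam + 1) ^ 2 + (2 * lam + 1)) := by positivity
  linear_combination h₅ / 4

theorem stmt11 (lam : ℝ) (hlam : -(1 / 2) < lam) (N : ℕ) (hN : 2 ≤ N)
    (dl dm : ℕ → ℝ)
    (hdl : ∀ n : ℕ, 1 ≤ n →
      dl (n + 1) = 1 / 4 * ((n : ℝ) * ((n : ℝ) + 2 * lam + 1)) /
        (((n : ℝ) + lam) * ((n : ℝ) + lam + 1)))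
    (hdm : ∀ n : ℕ, 1 ≤ n → dm (n + 1) = (n : ℝ) ^ 2 / (4 * (n : ℝ) ^ 2 - 1))
    (x1 : ℝ) (hroot : W (fun _ => 0) dm N x1 = 0)
    (hmax : ∀ y : ℝ, W (fun _ => 0) dm N y = 0 → y ≤ x1) :
    IsFinitePositiveChainSeq N (fun k => dm k / Real.cos (Real.pi / (2 * N)) ^ 2) ∧
    ∀ n, 1 ≤ n → n ≤ N - 1 →
      dl (n + 1) < dm (n + 1) ∧
      dm (n + 1) < dm (n + 1) / Real.cos (Real.pi / (2 * N)) ^ 2 ∧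
      dm (n + 1) / Real.cos (Real.pi / (2 * N)) ^ 2 < dm (n + 1) / x1 ^ 2 := by
  have hd : ∀ k, 0 < dm (k + 2) := by
    intro k
    rw [hdm (k + 1) (by omega)]
    have hk : (0 : ℝ) ≤ k := k.cast_nonneg
    push_cast
    exact div_pos (by positivity) (by nlinarith)
  have hN' : (2 : ℝ) ≤ N := by exact_mod_cast hN
  set θ : ℝ := Real.pi / (2 * N) with hθ_def
  have hθ : 0 < θ := by positivity
  have hNθ : N * θ = Real.pi / 2 := by rw [hθ_def]; field_simp
  have hθ_lt : θ < Real.pi / 2 := by nlinarith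
  have hcos : 0 < Real.cos θ := Real.cos_pos_of_mem_Ioo ⟨by linarith, hθ_lt⟩
  have hcos_lt : Real.cos θ < 1 := by
    rw [← Real.cos_zero]
    exact Real.cos_lt_cos_of_nonneg_of_le_pi_div_two le_rfl hθ_lt.le hθ
  have hpos : ∀ k ≤ N, 0 < W (fun _ => 0) dm k (Real.cos θ) :=
    fun k hk => legendre_W_pos hdm hθ hNθ.le hcos hk
  have hx1_lt : x1 < Real.cos θ := by
    by_contra! hle
    exact (W_pos_of_le hd hle hpos le_rfl).ne' hroot
  have hx1 : 0 < x1 := by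
    obtain ⟨m, rfl⟩ := Nat.exists_eq_add_of_le' hN
    obtain ⟨r, hr, hzero, -⟩ := exists_pos_zero_W hd m hpos
    exact hr.trans_le (hmax r hzero)
  refine ⟨isFinitePositiveChainSeq_div_sq hd hcos hpos, fun n hn _ => ⟨?_, ?_, ?_⟩⟩
  · rw [hdl n hn, hdm n hn]
    exact ultraspherical_coeff_lt_legendre_coeff hlam (by exact_mod_cast hn)
  all_goals
    obtain ⟨m, rfl⟩ := Nat.exists_eq_add_of_le' hn
    have hdn : 0 < dm (m + 1 + 1) := hd m
  · rw [lt_div_iff₀ (by positivity)]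
    exact mul_lt_of_lt_one_right hdn (pow_lt_one₀ hcos.le hcos_lt two_ne_zero)
  · exact div_lt_div_of_pos_left hdn (by positivity) (by gcongr)
end
end

section
/- Let {c_n}_{n≥1} be real, let {d_{n+1}}_{n≥1} be a positive chain sequence, and let W_n be defined by the recurrence. Let −1 < β < 1 and let ψ be a positive Borel measure on [−1,1] whose support is an infinite set contained in [−1, β]. Assume that for every n ≥ 1 and every F ∈ Ω_{n−1} one has ∫_{−1}^{1} F(x) W_n(x) dψ(x) = 0. Then for every n ≥ 1 the function W_n has no zeros in the closed interval [β, 1]. -/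
noncomputable section

/-- Membership in the class `Ω_n`: for `n ≥ 1`, `F : [-1,1] → ℝ` has the form
`F(x) = p(x) + √(1-x²) r(x)` with `deg p ≤ n`, `p(-x) = (-1)ⁿ p(x)`, `deg r ≤ n-1`,
`r(-x) = (-1)^{n-1} r(x)`; `Ω_0` consists of the constant functions. -/
def MemOmega : ℕ → (ℝ → ℝ) → Prop
  | 0, F => ∃ a : ℝ, ∀ x ∈ Set.Icc (-1 : ℝ) 1, F x = a
  | n + 1, F => ∃ p r : Polynomial ℝ, p.natDegree ≤ n + 1 ∧ r.natDegree ≤ n ∧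
      (∀ x : ℝ, p.eval (-x) = (-1 : ℝ) ^ (n + 1) * p.eval x) ∧
      (∀ x : ℝ, r.eval (-x) = (-1 : ℝ) ^ n * r.eval x) ∧
      ∀ x ∈ Set.Icc (-1 : ℝ) 1, F x = p.eval x + Real.sqrt (1 - x ^ 2) * r.eval x

/-- The support of a Borel measure on `ℝ`: points all of whose neighborhoods have
positive measure. -/
def msupport (ψ : MeasureTheory.Measure ℝ) : Set ℝ := {x | ∀ U ∈ nhds x, 0 < ψ U}

open Polynomial in
/-- `p + √(1-x²) r` is a representation of an element of `Ω_n`, with `r = 0` when `n = 0`. -/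
structure IsOmegaPair (n : ℕ) (p r : ℝ[X]) : Prop where
  degree_left : p.degree < (n + 1 : ℕ)
  degree_right : r.degree < (n : ℕ)
  parity_left : p.comp (-X) = (-1) ^ n * p
  parity_right : r.comp (-X) = -((-1) ^ n * r)

/-- The function `p(x) + √(1-x²) r(x)`. -/
def omegaEval (p r : Polynomial ℝ) (x : ℝ) : ℝ :=
  p.eval x + Real.sqrt (1 - x ^ 2) * r.eval x

lemma continuous_omegaEval (p r : Polynomial ℝ) : Continuous (omegaEval p r) := by
  unfold omegaEval
  fun_prop

lemma sq_sqrt_one_sub_sq {x : ℝ} (hx : x ∈ Set.Icc (-1 : ℝ) 1) :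
    Real.sqrt (1 - x ^ 2) ^ 2 = 1 - x ^ 2 :=
  Real.sq_sqrt (by nlinarith [hx.1, hx.2])

open Polynomial in
lemma IsOmegaPair.memOmega {n : ℕ} {p r : ℝ[X]} (h : IsOmegaPair n p r) :
    MemOmega n (omegaEval p r) := by
  have hp : p.natDegree ≤ n := natDegree_le_iff_degree_le.2 <| by
    rw [degree_le_iff_coeff_zero]
    intro m hm
    exact (degree_lt_iff_coeff_zero p (n + 1)).1 h.degree_left m (by exact_mod_cast hm)
  cases n with
  | zero =>
    have hr : r = 0 := by
      ext m
      exact (degree_lt_iff_coeff_zero r 0).1 h.degree_right m (Nat.zero_le m)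
    obtain ⟨a, rfl⟩ := natDegree_eq_zero.1 (Nat.le_zero.1 hp)
    exact ⟨a, fun x _ => by simp [omegaEval, hr]⟩
  | succ n =>
    refine ⟨p, r, hp, ?_, fun x => ?_, fun x => ?_, fun x _ => rfl⟩
    · rw [natDegree_le_iff_degree_le, degree_le_iff_coeff_zero]
      intro m hm
      have hm' : n < m := by exact_mod_cast hm
      exact (degree_lt_iff_coeff_zero r (n + 1)).1 h.degree_right m hm'
    · simpa using congrArg (eval x) h.parity_left
    · simpa [pow_succ] using congrArg (eval x) h.parity_right

open Polynomial in
/-- The `Ω_n` representation of `W_n`. -/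
lemma exists_isOmegaPair_W (c d : ℕ → ℝ) (n : ℕ) :
    ∃ p r : ℝ[X], IsOmegaPair n p r ∧
      ∀ x ∈ Set.Icc (-1 : ℝ) 1, W c d n x = omegaEval p r x := by
  induction n using Nat.strong_induction_on with
  | _ n ih =>
  match n, ih with
  | 0, _ =>
    exact ⟨1, 0, ⟨by simp, by simp, by simp, by simp⟩, fun x _ => by simp [omegaEval, W]⟩
  | 1, _ =>
    refine ⟨X, -C (c 1), ⟨by rw [degree_X]; norm_num, ?_, by simp, by simp⟩, fun x _ => ?_⟩
    · rw [degree_neg]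
      exact degree_C_le.trans_lt (by norm_num)
    · simp only [omegaEval, W, eval_X, eval_neg, eval_C]
      ring
  | n + 2, ih =>
    obtain ⟨p, r, h, hW⟩ := ih (n + 1) (by omega)
    obtain ⟨p₀, r₀, h₀, hW₀⟩ := ih n (by omega)
    have hp := (degree_lt_iff_coeff_zero _ _).1 h.degree_left
    have hr := (degree_lt_iff_coeff_zero _ _).1 h.degree_right
    have hp₀ := (degree_lt_iff_coeff_zero _ _).1 h₀.degree_left
    have hr₀ := (degree_lt_iff_coeff_zero _ _).1 h₀.degree_right
    refine ⟨X * p - C (c (n + 2)) * (r - X * (X * r)) - C (d (n + 2)) * p₀,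
      X * r - C (c (n + 2)) * p - C (d (n + 2)) * r₀, ⟨?_, ?_, ?_, ?_⟩, fun x hx => ?_⟩
    · rw [degree_lt_iff_coeff_zero]
      intro m hm
      obtain ⟨k, rfl⟩ : ∃ k, m = k + 2 := ⟨m - 2, by omega⟩
      simp only [coeff_sub, coeff_C_mul, coeff_X_mul]
      rw [hp (k + 1) (by omega), hr (k + 2) (by omega), hr k (by omega), hp₀ (k + 2) (by omega)]
      simp
    · rw [degree_lt_iff_coeff_zero]
      intro m hm
      obtain ⟨k, rfl⟩ : ∃ k, m = k + 1 := ⟨m - 1, by omega⟩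
      simp only [coeff_sub, coeff_C_mul, coeff_X_mul]
      rw [hr k (by omega), hp (k + 1) (by omega), hr₀ (k + 1) (by omega)]
      simp
    · simp only [sub_comp, mul_comp, X_comp, C_comp, h.parity_left, h.parity_right, h₀.parity_left]
      ring
    · simp only [sub_comp, mul_comp, X_comp, C_comp, h.parity_left, h.parity_right,
        h₀.parity_right]
      ring
    · rw [W, hW x hx, hW₀ x hx]
      simp only [omegaEval, eval_sub, eval_mul, eval_X, eval_C]
      linear_combination (-c (n + 2) * r.eval x) * sq_sqrt_one_sub_sq hx

lemma W_one_pos (c d : ℕ → ℝ) (hd : IsPositiveChainSeq d) (n : ℕ) : 0 < W c d n 1 := by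
  obtain ⟨g, ⟨hg0, hg1⟩, hg, hdg⟩ := hd
  have hlt : ∀ k, g (k + 1) < 1
    | 0 => hg1
    | k + 1 => (hg (k + 2) (by omega)).2
  have key : ∀ k, 0 < W c d k 1 ∧ (1 - g (k + 1)) * W c d k 1 ≤ W c d (k + 1) 1 := by
    intro k
    induction k with
    | zero => simp [W, hg0]
    | succ k ih =>
      refine ⟨(mul_pos (sub_pos.2 (hlt k)) ih.1).trans_le ih.2, ?_⟩
      have hrec : W c d (k + 2) 1 = W c d (k + 1) 1 - d (k + 2) * W c d k 1 := by simp [W]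
      rw [hrec, hdg (k + 1) (by omega)]
      nlinarith [mul_le_mul_of_nonneg_left ih.2 (hg (k + 2) (by omega)).1.le]
  exact (key n).1

open Polynomial in
lemma X_sq_sub_C_sq_dvd {a : ℝ} {q : ℝ[X]} (ha : a ≠ 0) (h₁ : q.eval a = 0)
    (h₂ : q.eval (-a) = 0) : X ^ 2 - C (a ^ 2) ∣ q := by
  have hco : IsCoprime (X - C a) (X - C (-a)) :=
    isCoprime_X_sub_C_of_isUnit_sub (by
      rw [isUnit_iff_ne_zero]
      intro h
      exact ha (by linarith))
  have := hco.mul_dvd (dvd_iff_isRoot.2 h₁) (dvd_iff_isRoot.2 h₂)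
  convert this using 1
  simp only [map_neg, map_pow]
  ring

open Polynomial in
lemma comp_neg_X_of_mul_eq {a : ℝ} {q t : ℝ[X]} {n : ℕ} (hq : q.comp (-X) = (-1) ^ n * q)
    (h : q = (X ^ 2 - C (a ^ 2)) * t) : t.comp (-X) = (-1) ^ n * t := by
  have h0 : X ^ 2 - C (a ^ 2) ≠ 0 := X_pow_sub_C_ne_zero two_pos _
  refine mul_left_cancel₀ h0 ?_
  have := congrArg (fun u : ℝ[X] => u.comp (-X)) h
  simp only [mul_comp, sub_comp, pow_comp, X_comp, C_comp, hq] at this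
  rw [h] at this
  linear_combination -this

open Polynomial in
lemma degree_lt_of_mul_eq {a : ℝ} {q t : ℝ[X]} {n : ℕ} (hq : q.degree < (n + 2 : ℕ))
    (h : q = (X ^ 2 - C (a ^ 2)) * t) : t.degree < (n : ℕ) := by
  by_cases ht : t = 0
  · simp [ht]
  rw [h, degree_mul, degree_X_pow_sub_C two_pos, degree_eq_natDegree ht] at hq
  rw [degree_eq_natDegree ht]
  norm_cast at hq ⊢
  omega

open Polynomial in
/-- A zero of an element of `Ω_{n+1}` splits off a factor `√(1-x²) a - x √(1-a²)`,
that is, `sin (arccos x - arccos a)`. -/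
lemma IsOmegaPair.exists_factor {n : ℕ} {p r : ℝ[X]} (h : IsOmegaPair (n + 1) p r) {a : ℝ}
    (ha : a ∈ Set.Icc (-1 : ℝ) 1) (hz : omegaEval p r a = 0) :
    ∃ P R : ℝ[X], IsOmegaPair n P R ∧ ∀ x ∈ Set.Icc (-1 : ℝ) 1,
      omegaEval p r x =
        (Real.sqrt (1 - x ^ 2) * a - x * Real.sqrt (1 - a ^ 2)) * omegaEval P R x := by
  have hb : Real.sqrt (1 - a ^ 2) ^ 2 = 1 - a ^ 2 := sq_sqrt_one_sub_sq ha
  unfold omegaEval at hz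
  set b := Real.sqrt (1 - a ^ 2) with hbdef
  have hp := (degree_lt_iff_coeff_zero _ _).1 h.degree_left
  have hr := (degree_lt_iff_coeff_zero _ _).1 h.degree_right
  set A : ℝ[X] := C (-b) * (X * p) - C a * (r - X * (X * r)) with hA
  set B : ℝ[X] := -(C a * p) - C b * (X * r) with hB
  have hApar : A.comp (-X) = (-1) ^ n * A := by
    simp only [hA, sub_comp, mul_comp, X_comp, C_comp, h.parity_left, h.parity_right]
    ring
  have hBpar : B.comp (-X) = (-1) ^ (n + 1) * B := by
    simp only [hB, sub_comp, mul_comp, X_comp, C_comp, neg_comp, h.parity_left, h.parity_right]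
    ring
  have hAdeg : A.degree < (n + 1 + 2 : ℕ) := by
    rw [degree_lt_iff_coeff_zero]
    intro m hm
    obtain ⟨k, rfl⟩ : ∃ k, m = k + 2 := ⟨m - 2, by omega⟩
    simp only [hA, coeff_sub, coeff_C_mul, coeff_X_mul]
    rw [hp (k + 1) (by omega), hr (k + 2) (by omega), hr k (by omega)]
    simp
  have hBdeg : B.degree < (n + 2 : ℕ) := by
    rw [degree_lt_iff_coeff_zero]
    intro m hm
    obtain ⟨k, rfl⟩ : ∃ k, m = k + 1 := ⟨m - 1, by omega⟩
    simp only [hB, coeff_sub, coeff_C_mul, coeff_X_mul, coeff_neg]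
    rw [hp (k + 1) (by omega), hr k (by omega)]
    simp
  have hdvd : X ^ 2 - C (a ^ 2) ∣ A ∧ X ^ 2 - C (a ^ 2) ∣ B := by
    by_cases ha0 : a = 0
    · have hb1 : b = 1 := by simp [hbdef, ha0]
      have hz' : p.eval 0 + r.eval 0 = 0 := by simpa [ha0, hb1] using hz
      have hpe : p.eval 0 = (-1) ^ (n + 1) * p.eval 0 := by
        simpa using congrArg (eval 0) h.parity_left
      have hre : r.eval 0 = -((-1) ^ (n + 1) * r.eval 0) := by
        simpa using congrArg (eval 0) h.parity_right
      have hp0 : p.eval 0 = 0 := by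
        rcases neg_one_pow_eq_or ℝ (n + 1) with h1 | h1 <;> rw [h1] at hpe hre <;> linarith
      have hr0 : r.eval 0 = 0 := by linarith
      obtain ⟨u, hu⟩ : X ∣ p := X_dvd_iff.2 (by rw [coeff_zero_eq_eval_zero, hp0])
      obtain ⟨v, hv⟩ : X ∣ r := X_dvd_iff.2 (by rw [coeff_zero_eq_eval_zero, hr0])
      constructor
      · exact ⟨-u, by simp only [hA, ha0, hb1, hu, map_neg, map_one, map_zero, ne_eq,
          OfNat.ofNat_ne_zero, not_false_eq_true, zero_pow]; ring⟩
      · exact ⟨-v, by simp only [hB, ha0, hb1, hv, map_one, map_zero, ne_eq,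
          OfNat.ofNat_ne_zero, not_false_eq_true, zero_pow]; ring⟩
    · have hA0 : A.eval a = 0 := by
        simp only [hA, eval_sub, eval_mul, eval_X, eval_C]
        linear_combination (-(a * b)) * hz + (a * r.eval a) * hb
      have hB0 : B.eval a = 0 := by
        simp only [hB, eval_sub, eval_mul, eval_X, eval_C, eval_neg]
        linear_combination (-a) * hz
      refine ⟨X_sq_sub_C_sq_dvd ha0 hA0 ?_, X_sq_sub_C_sq_dvd ha0 hB0 ?_⟩
      · simpa [hA0] using congrArg (eval a) hApar
      · simpa [hB0] using congrArg (eval a) hBpar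
  obtain ⟨⟨P, hP⟩, ⟨R, hR⟩⟩ := hdvd
  have hCb : C b ^ 2 = 1 - C a ^ 2 := by
    rw [← C_pow, hb]
    simp
  have h0 : X ^ 2 - C (a ^ 2) ≠ 0 := X_pow_sub_C_ne_zero two_pos _
  have hpeq : p = C a * (1 - X ^ 2) * R - C b * X * P := by
    refine mul_left_cancel₀ h0 ?_
    have hP' := hP
    have hR' := hR
    simp only [hA, hB, map_neg, map_pow] at hP' hR' ⊢
    linear_combination (-(X * C b)) * hP' + (C a * (1 - X ^ 2)) * hR' - (X ^ 2 * p) * hCb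
  have hreq : r = C a * P - C b * X * R := by
    refine mul_left_cancel₀ h0 ?_
    have hP' := hP
    have hR' := hR
    simp only [hA, hB, map_neg, map_pow] at hP' hR' ⊢
    linear_combination (C a) * hP' - (C b * X) * hR' - (X ^ 2 * r) * hCb
  refine ⟨P, R, ⟨degree_lt_of_mul_eq hAdeg hP, degree_lt_of_mul_eq hBdeg hR,
    comp_neg_X_of_mul_eq hApar hP, ?_⟩, fun x hx => ?_⟩
  · rw [comp_neg_X_of_mul_eq hBpar hR]
    ring
  · rw [hpeq, hreq]
    simp only [omegaEval, eval_sub, eval_mul, eval_X, eval_C, eval_one, eval_pow]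
    linear_combination (-(a * R.eval x)) * sq_sqrt_one_sub_sq hx

/-- An `Ω_n` function with infinitely many zeros in `[-1,1]` vanishes at `1`. -/
lemma omegaEval_one_eq_zero {p r : Polynomial ℝ} {s : Set ℝ} (hs : s.Infinite)
    (hs1 : s ⊆ Set.Icc (-1 : ℝ) 1) (h : ∀ x ∈ s, omegaEval p r x = 0) :
    omegaEval p r 1 = 0 := by
  have hpoly : p ^ 2 = (1 - Polynomial.X ^ 2) * r ^ 2 := by
    refine Polynomial.eq_of_infinite_eval_eq _ _ (hs.mono fun x hx => ?_)
    have hx0 := h x hx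
    unfold omegaEval at hx0
    simp only [Set.mem_ofPred_eq, Polynomial.eval_pow, Polynomial.eval_mul, Polynomial.eval_sub,
      Polynomial.eval_one, Polynomial.eval_X]
    rw [← sq_sqrt_one_sub_sq (hs1 hx)]
    linear_combination (p.eval x - Real.sqrt (1 - x ^ 2) * r.eval x) * hx0
  have := congrArg (Polynomial.eval 1) hpoly
  simpa [omegaEval] using this

lemma sqrt_mul_sub_mul_sqrt_nonneg {x a : ℝ} (hx : -1 ≤ x) (hxa : x ≤ a) (ha : a ≤ 1) :
    0 ≤ Real.sqrt (1 - x ^ 2) * a - x * Real.sqrt (1 - a ^ 2) := by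
  have h : 0 ≤ Real.sin (Real.arccos x - Real.arccos a) :=
    Real.sin_nonneg_of_nonneg_of_le_pi
      (sub_nonneg.2 (Real.antitone_arccos hxa))
      (by linarith [Real.arccos_le_pi x, Real.arccos_nonneg a])
  rwa [Real.sin_sub, Real.sin_arccos, Real.sin_arccos, Real.cos_arccos hx (hxa.trans ha),
    Real.cos_arccos (hx.trans hxa) ha] at h

open MeasureTheory in
lemma ae_mem_msupport (ψ : Measure ℝ) : ∀ᵐ x ∂ψ, x ∈ msupport ψ := by
  have h : msupport ψ = ψ.support := by
    ext x
    rw [Measure.mem_support_iff_forall]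
    rfl
  rw [h]
  exact Measure.support_mem_ae

open MeasureTheory in
/-- A continuous function which is nonnegative on the support of `ψ` and has zero integral
vanishes on the support. -/
lemma eq_zero_of_setIntegral_eq_zero {ψ : Measure ℝ} [IsFiniteMeasure ψ] {f : ℝ → ℝ}
    (hnull : ψ (Set.Icc (-1 : ℝ) 1)ᶜ = 0) (hf : Continuous f)
    (hnn : ∀ x ∈ msupport ψ, 0 ≤ f x) (hint : ∫ x in Set.Icc (-1 : ℝ) 1, f x ∂ψ = 0) :
    ∀ x ∈ msupport ψ, f x = 0 := by
  have hae : f =ᵐ[ψ.restrict (Set.Icc (-1) 1)] 0 :=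
    (integral_eq_zero_iff_of_nonneg_ae
      (ae_restrict_of_ae ((ae_mem_msupport ψ).mono hnn))
      hf.continuousOn.integrableOn_Icc).1 hint
  rw [Measure.restrict_eq_self_of_ae_mem (s := Set.Icc (-1) 1) (mem_ae_iff.2 hnull)] at hae
  intro x hx
  by_contra hne
  exact (hx {y | f y ≠ 0} ((hf.continuousAt).eventually_ne hne)).ne' (ae_iff.1 hae)

open MeasureTheory in
theorem stmt14 (c d : ℕ → ℝ) (hd : IsPositiveChainSeq d)
    (β : ℝ) (hβ : β ∈ Set.Ioo (-1 : ℝ) 1)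
    (ψ : Measure ℝ) [IsFiniteMeasure ψ]
    (hnull : ψ (Set.Icc (-1 : ℝ) 1)ᶜ = 0)
    (hsupp : msupport ψ ⊆ Set.Icc (-1) β)
    (hinf : (msupport ψ).Infinite)
    (horth : ∀ n, 1 ≤ n → ∀ F : ℝ → ℝ, MemOmega (n - 1) F →
      ∫ x in Set.Icc (-1 : ℝ) 1, F x * W c d n x ∂ψ = 0) :
    ∀ n, 1 ≤ n → ∀ x ∈ Set.Icc β 1, W c d n x ≠ 0 := by
  intro n hn a ha hzero
  obtain ⟨n, rfl⟩ : ∃ k, n = k + 1 := ⟨n - 1, by omega⟩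
  have ha1 : a ∈ Set.Icc (-1 : ℝ) 1 := ⟨hβ.1.le.trans ha.1, ha.2⟩
  have hsub : msupport ψ ⊆ Set.Icc (-1 : ℝ) 1 :=
    hsupp.trans (Set.Icc_subset_Icc_right hβ.2.le)
  obtain ⟨p, r, hpr, hW⟩ := exists_isOmegaPair_W c d (n + 1)
  rw [hW a ha1] at hzero
  obtain ⟨P, R, hPR, hfac⟩ := hpr.exists_factor ha1 hzero
  have hint := horth (n + 1) hn _ hPR.memOmega
  rw [setIntegral_congr_fun (g := fun x =>
    (Real.sqrt (1 - x ^ 2) * a - x * Real.sqrt (1 - a ^ 2)) * omegaEval P R x ^ 2)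
    measurableSet_Icc fun x hx => by
      simp only [hW x hx, hfac x hx]
      ring] at hint
  have hvanish := eq_zero_of_setIntegral_eq_zero hnull
    (((by fun_prop : Continuous fun x : ℝ =>
      Real.sqrt (1 - x ^ 2) * a - x * Real.sqrt (1 - a ^ 2))).mul
        ((continuous_omegaEval P R).pow 2))
    (fun x hx => mul_nonneg (sqrt_mul_sub_mul_sqrt_nonneg (hsupp hx).1
      ((hsupp hx).2.trans ha.1) ha.2) (sq_nonneg _)) hint
  have hpos := W_one_pos c d hd (n + 1)
  rw [hW 1 (by norm_num)] at hpos
  refine hpos.ne' (omegaEval_one_eq_zero hinf hsub fun x hx => ?_)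
  rw [hfac x (hsub hx)]
  rcases mul_eq_zero.1 (hvanish x hx) with h | h
  · exact mul_eq_zero_of_left h _
  · exact mul_eq_zero_of_right _ ((pow_eq_zero_iff two_ne_zero).1 h)
end
end
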